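/- Let A be a prime noetherian ring of injective dimension one that either is hereditary or has an A_1 singularity, and let N be a nonzero finitely generated torsionfree right A-module. Then there exists a finitely generated projective right A-module L and a short exact sequence 0 → N → L → N → 0. -/

import Mathlib

/- STATEMENT 3:
Let `A` be a prime noetherian ring of injective dimension one that either is hereditary or has
an `A_1` singularity, and let `N` be a nonzero finitely generated torsionfree right `A`-module.
Then there exist a finitely generated projective right `A`-module `L` and a short exact
sequence `0 → N → L → N → 0`.

Right `A`-modules are modules over `Aᵐᵒᵖ`. The `A_1`-singularity condition is expressed via a
generator `M` of the singularity category `Sing(A) = MCM/(projectives)`: every MCM module is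
stably isomorphic to a direct sum of copies of `M`, the stable endomorphism ring of `M` is `k`,
and the first syzygy of `M` is stably isomorphic to `M`. -/

open CategoryTheory

def IsPrimeRing (A : Type) [Ring A] : Prop :=
  ∀ a b : A, (∀ x : A, a * x * b = 0) → a = 0 ∨ b = 0

noncomputable abbrev extGrp (B : Type) [Ring B] (n : ℕ) (M N : ModuleCat B) : Type :=
  ((Ext ℤ (ModuleCat B) n).obj (Opposite.op M)).obj N

def RightTorsionFree (A : Type) [Ring A] (M : Type) [AddCommGroup M] [Module Aᵐᵒᵖ M] : Prop :=
  ∀ m : M, m ≠ 0 → ∀ a ∈ nonZeroDivisors A, (MulOpposite.op a) • m ≠ 0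

def RightSelfInjDimLE (A : Type) [Ring A] (d : ℕ) : Prop :=
  ∀ (M : ModuleCat Aᵐᵒᵖ) (n : ℕ), d < n →
    Subsingleton (extGrp Aᵐᵒᵖ n M (ModuleCat.of Aᵐᵒᵖ Aᵐᵒᵖ))

def LeftSelfInjDimLE (A : Type) [Ring A] (d : ℕ) : Prop :=
  ∀ (M : ModuleCat A) (n : ℕ), d < n →
    Subsingleton (extGrp A n M (ModuleCat.of A A))

/-- `A` is (right) hereditary: right global dimension at most one. -/
def IsHereditaryRing (A : Type) [Ring A] : Prop :=
  ∀ (M N : ModuleCat Aᵐᵒᵖ) (n : ℕ), 1 < n → Subsingleton (extGrp Aᵐᵒᵖ n M N)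

/-- A right `A`-module is maximal Cohen--Macaulay if `Ext^n(M, A) = 0` for all `n > 0`. -/
def IsMCM (A : Type) [Ring A] (M : Type) [AddCommGroup M] [Module Aᵐᵒᵖ M] : Prop :=
  ∀ n : ℕ, 0 < n →
    Subsingleton (extGrp Aᵐᵒᵖ n (ModuleCat.of Aᵐᵒᵖ M) (ModuleCat.of Aᵐᵒᵖ Aᵐᵒᵖ))

/-- A map of right `A`-modules factors through a projective module. -/
def FactorsThroughProjective (A : Type) [Ring A] {M N : Type}
    [AddCommGroup M] [Module Aᵐᵒᵖ M] [AddCommGroup N] [Module Aᵐᵒᵖ N]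
    (f : M →ₗ[Aᵐᵒᵖ] N) : Prop :=
  ∃ (P : ModuleCat.{0} Aᵐᵒᵖ), Module.Projective Aᵐᵒᵖ P ∧
    ∃ (u : M →ₗ[Aᵐᵒᵖ] P) (v : P →ₗ[Aᵐᵒᵖ] N), v ∘ₗ u = f

/-- Two right `A`-modules are stably isomorphic (isomorphic in the stable category). -/
def StablyIso (A : Type) [Ring A] (M N : Type)
    [AddCommGroup M] [Module Aᵐᵒᵖ M] [AddCommGroup N] [Module Aᵐᵒᵖ N] : Prop :=
  ∃ (P Q : ModuleCat.{0} Aᵐᵒᵖ), Module.Projective Aᵐᵒᵖ P ∧ Module.Projective Aᵐᵒᵖ Q ∧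
    Module.Finite Aᵐᵒᵖ P ∧ Module.Finite Aᵐᵒᵖ Q ∧
    Nonempty ((M × P) ≃ₗ[Aᵐᵒᵖ] (N × Q))

/-- The `k`-scalar endomorphism `m ↦ algebraMap k Aᵐᵒᵖ c • m` of a right `A`-module. -/
def scalarEndo (k A : Type) [CommRing k] [Ring A] [Algebra k A] (M : Type)
    [AddCommGroup M] [Module Aᵐᵒᵖ M] (c : k) : M →ₗ[Aᵐᵒᵖ] M where
  toFun m := (algebraMap k Aᵐᵒᵖ c) • m
  map_add' m m' := smul_add _ m m'
  map_smul' a m := by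
    simp only [RingHom.id_apply, ← mul_smul, Algebra.commutes]

/-- `M` is a generator of the singularity category of `A`, which is equivalent to the category
of `k`-vector spaces with trivial shift (an `A_1` singularity). -/
def IsA1Generator (k A : Type) [Field k] [Ring A] [Algebra k A] (M : Type)
    [AddCommGroup M] [Module Aᵐᵒᵖ M] : Prop :=
  Module.Finite Aᵐᵒᵖ M ∧ IsMCM A M ∧ ¬ Module.Projective Aᵐᵒᵖ M ∧
  -- every MCM module is stably isomorphic to a direct sum of copies of `M`:
  (∀ (N : ModuleCat Aᵐᵒᵖ), Module.Finite Aᵐᵒᵖ N → IsMCM A N →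
      ∃ s : ℕ, StablyIso A N (Fin s → M)) ∧
  -- the stable endomorphism ring of `M` is `k`:
  (∀ f : M →ₗ[Aᵐᵒᵖ] M, ∃ c : k, FactorsThroughProjective A (f - scalarEndo k A M c)) ∧
  (∀ c : k, c ≠ 0 → ¬ FactorsThroughProjective A (scalarEndo k A M c)) ∧
  -- the first syzygy of `M` is stably isomorphic to `M`:
  (∃ (P : ModuleCat.{0} Aᵐᵒᵖ) (p : P →ₗ[Aᵐᵒᵖ] M), Module.Projective Aᵐᵒᵖ P ∧
      Module.Finite Aᵐᵒᵖ P ∧ Function.Surjective p ∧ StablyIso A (LinearMap.ker p) M)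

/-- `A` has an `A_1` singularity. -/
def HasA1Singularity (k A : Type) [Field k] [Ring A] [Algebra k A] : Prop :=
  ∃ M : ModuleCat Aᵐᵒᵖ, IsA1Generator k A M

section Essential

variable {R N P : Type*} [Ring R] [AddCommGroup N] [Module R N] [AddCommGroup P] [Module R P]

/-- A submodule is essential if every nonzero element has a nonzero multiple in it. -/
def IsEssentialSubmodule (E : Submodule R N) : Prop :=
  ∀ x : N, x ≠ 0 → ∃ r : R, r • x ∈ E ∧ r • x ≠ 0

namespace IsEssentialSubmodule

lemma mono {E F : Submodule R N} (hE : IsEssentialSubmodule E) (h : E ≤ F) :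
    IsEssentialSubmodule F := fun x hx =>
  let ⟨r, hr, hr0⟩ := hE x hx
  ⟨r, h hr, hr0⟩

lemma top : IsEssentialSubmodule (⊤ : Submodule R N) := fun x hx => ⟨1, trivial, by simpa⟩

lemma inf {E F : Submodule R N} (hE : IsEssentialSubmodule E) (hF : IsEssentialSubmodule F) :
    IsEssentialSubmodule (E ⊓ F) := by
  intro x hx
  obtain ⟨r, hr, hr0⟩ := hE x hx
  obtain ⟨s, hs, hs0⟩ := hF _ hr0
  refine ⟨s * r, ⟨?_, ?_⟩, ?_⟩ <;> rw [mul_smul]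
  exacts [E.smul_mem s hr, hs, hs0]

lemma comap {E : Submodule R N} (hE : IsEssentialSubmodule E) (f : P →ₗ[R] N) :
    IsEssentialSubmodule (E.comap f) := by
  intro x hx
  by_cases h : f x = 0
  · exact ⟨1, by simp [h], by simpa⟩
  · obtain ⟨r, hr, hr0⟩ := hE _ h
    refine ⟨r, by simpa using hr, fun h0 => hr0 ?_⟩
    rw [← map_smul, h0, map_zero]

end IsEssentialSubmodule

lemma exists_disjoint_sup_isEssential [IsNoetherian R N] (U : Submodule R N) :
    ∃ V : Submodule R N, Disjoint U V ∧ IsEssentialSubmodule (U ⊔ V) := by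
  obtain ⟨V, hV, hmax⟩ := (set_has_maximal_iff_noetherian (R := R) (M := N)).2 inferInstance
    {V | Disjoint U V} ⟨⊥, disjoint_bot_right⟩
  refine ⟨V, hV, fun x hx => ?_⟩
  by_cases hxV : x ∈ V
  · exact ⟨1, by simpa using Submodule.mem_sup_right hxV, by simpa⟩
  have hlt : V < V ⊔ Submodule.span R {x} := by
    refine lt_of_le_of_ne le_sup_left fun h => hxV ?_
    rw [h]
    exact Submodule.mem_sup_right (Submodule.mem_span_singleton_self x)
  have hnd : ¬ Disjoint U (V ⊔ Submodule.span R {x}) := fun h => hmax _ h hlt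
  rw [Submodule.disjoint_def] at hnd
  push Not at hnd
  obtain ⟨u, hu, hu', hu0⟩ := hnd
  obtain ⟨v, hv, w, hw, rfl⟩ := Submodule.mem_sup.1 hu'
  obtain ⟨r, rfl⟩ := Submodule.mem_span_singleton.1 hw
  refine ⟨r, ?_, fun h => hu0 ?_⟩
  · have : r • x = (v + r • x) - v := by abel
    rw [this]
    exact sub_mem (Submodule.mem_sup_left hu) (Submodule.mem_sup_right hv)
  · rw [h, add_zero] at hu ⊢
    exact Submodule.disjoint_def.1 hV v hu hv

end Essential

section Goldie

variable {R : Type} [Ring R]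

lemma IsPrimeRing.op (h : IsPrimeRing R) : IsPrimeRing Rᵐᵒᵖ := by
  intro a b hab
  rcases h b.unop a.unop fun x => by
    simpa [mul_assoc] using congrArg MulOpposite.unop (hab (.op x)) with h | h
  · exact .inr (MulOpposite.unop_injective h)
  · exact .inl (MulOpposite.unop_injective h)

/-- The left annihilator of an element. -/
def leftAnnihilator (c : R) : Ideal R := LinearMap.ker (LinearMap.toSpanSingleton R R c)

@[simp]
lemma mem_leftAnnihilator {c r : R} : r ∈ leftAnnihilator c ↔ r * c = 0 := by
  simp [leftAnnihilator]

/-- A left noetherian prime ring is left nonsingular. -/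
lemma IsPrimeRing.eq_zero_of_isEssential_leftAnnihilator (h : IsPrimeRing R)
    [IsNoetherianRing R] {z : R} (hz : IsEssentialSubmodule (leftAnnihilator z)) : z = 0 := by
  by_contra hz0
  obtain ⟨_, ⟨z, hz, hz0, rfl⟩, hmax⟩ :=
    (set_has_maximal_iff_noetherian (R := R) (M := R)).2 inferInstance
    {I | ∃ z : R, IsEssentialSubmodule (leftAnnihilator z) ∧ z ≠ 0 ∧ leftAnnihilator z = I}
    ⟨_, z, hz, hz0, rfl⟩
  refine hz0 ((or_self_iff).1 (h z z fun a => ?_))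
  by_contra hza
  have hle : leftAnnihilator z ≤ leftAnnihilator (z * a * z) := fun r hr => by
    simp only [mem_leftAnnihilator] at hr ⊢
    simp [← mul_assoc, hr]
  have heq : leftAnnihilator z = leftAnnihilator (z * a * z) := by
    by_contra hne
    exact hmax _ ⟨_, hz.mono hle, hza, rfl⟩ (lt_of_le_of_ne hle hne)
  have haz : IsEssentialSubmodule (leftAnnihilator (a * z)) :=
    (hz.comap (LinearMap.toSpanSingleton R R a)).mono fun r hr => by
      simpa [mul_assoc] using hr
  obtain ⟨r, hr, hr0⟩ := haz z hz0
  refine hr0 ?_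
  have : r ∈ leftAnnihilator (z * a * z) := by simpa [mul_assoc] using hr
  rw [← heq] at this
  simpa using this

lemma IsPrimeRing.exists_mul_ne_zero_of_isEssential (h : IsPrimeRing R) [IsNoetherianRing R]
    {I : Ideal R} (hI : IsEssentialSubmodule I) {z : R} (hz : z ≠ 0) : ∃ r ∈ I, r * z ≠ 0 := by
  by_contra! hc
  exact hz (h.eq_zero_of_isEssential_leftAnnihilator (hI.mono fun r hr => by simpa using hc r hr))

lemma isEssential_span_singleton [IsNoetherianRing R] {c : R} (hc : ∀ x, x * c = 0 → x = 0) :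
    IsEssentialSubmodule (Ideal.span {c}) := by
  intro y hy
  by_contra! hcon
  let f : R × Submodule.span R {y} →ₗ[R] R :=
    (LinearMap.toSpanSingleton R R c).coprod (Submodule.span R {y}).subtype
  have hf : Function.Injective f := by
    rw [injective_iff_map_eq_zero]
    rintro ⟨a, b, hb⟩ hab
    obtain ⟨r, rfl⟩ := Submodule.mem_span_singleton.1 hb
    have hab : a * c + r * y = 0 := by simpa [f] using hab
    have hr : r • y = 0 := hcon r (Ideal.mem_span_singleton'.2 ⟨-a, by
      rw [smul_eq_mul, neg_mul]; exact neg_eq_of_add_eq_zero_right hab⟩)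
    rw [smul_eq_mul] at hr
    rw [hr, add_zero] at hab
    simp [hc _ hab, hr]
  have := IsNoetherian.subsingleton_of_prod_injective f hf
  exact hy (congrArg Subtype.val
    (Subsingleton.elim (⟨y, Submodule.mem_span_singleton_self y⟩ : Submodule.span R {y}) 0))

lemma IsPrimeRing.mul_right_injective_of_isEssential_span (h : IsPrimeRing R) [IsNoetherianRing R]
    {c : R} (hc : IsEssentialSubmodule (Ideal.span {c})) : leftAnnihilator c = ⊥ := by
  let f : Module.End R R := LinearMap.toSpanSingleton R R c
  have hpow : ∀ n : ℕ, IsEssentialSubmodule (LinearMap.range (f ^ n)) := by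
    intro n
    induction n with
    | zero => exact IsEssentialSubmodule.top.mono fun x _ => ⟨x, rfl⟩
    | succ n ih =>
      intro y hy
      obtain ⟨r, hr, hr0⟩ := hc y hy
      obtain ⟨x, hx⟩ := Ideal.mem_span_singleton'.1 hr
      obtain ⟨s, ⟨t, ht⟩, hs⟩ := h.exists_mul_ne_zero_of_isEssential
        (ih.comap (LinearMap.toSpanSingleton R R x)) hr0
      refine ⟨s * r, ⟨t, ?_⟩, by simpa [mul_assoc] using hs⟩
      rw [pow_succ', Module.End.mul_apply, ht]
      simp only [f, LinearMap.toSpanSingleton_apply, smul_eq_mul] at hx ⊢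
      rw [mul_assoc, hx, mul_assoc]
  obtain ⟨n, hn, hn0⟩ := (f.eventually_disjoint_ker_pow_range_pow.and
    (Filter.eventually_ne_atTop 0)).exists
  rw [Submodule.eq_bot_iff]
  intro x hx
  by_contra hx0
  obtain ⟨r, hr, hr0⟩ := hpow n x hx0
  refine hr0 (Submodule.disjoint_def.1 hn _ (Submodule.smul_mem _ r ?_) hr)
  obtain ⟨m, rfl⟩ := Nat.exists_eq_succ_of_ne_zero hn0
  have : f x = 0 := by simpa [f] using hx
  simp [pow_succ, this]

/-- Goldie: an essential left ideal of a prime noetherian ring contains a regular element. -/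
lemma IsPrimeRing.exists_mem_nonZeroDivisors_of_isEssential (h : IsPrimeRing R)
    [IsNoetherianRing R] [IsNoetherianRing Rᵐᵒᵖ] {I : Ideal R} (hI : IsEssentialSubmodule I) :
    ∃ c ∈ I, c ∈ nonZeroDivisors R := by
  let ann : R → Ideal Rᵐᵒᵖ := fun c => ⨅ l : leftAnnihilator c, leftAnnihilator (.op (l : R))
  have mem_ann (c x : R) : .op x ∈ ann c ↔ ∀ l, l * c = 0 → l * x = 0 := by
    simp [ann, ← MulOpposite.op_mul]
  obtain ⟨_, ⟨c, hcI, rfl⟩, hmax⟩ :=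
    (set_has_maximal_iff_noetherian (R := Rᵐᵒᵖ) (M := Rᵐᵒᵖ)).2 inferInstance
    (ann '' I) ⟨_, 0, I.zero_mem, rfl⟩
  have hc : leftAnnihilator c = ⊥ := by
    by_cases hess : IsEssentialSubmodule (Ideal.span {c})
    · exact h.mul_right_injective_of_isEssential_span hess
    simp only [IsEssentialSubmodule, not_forall, not_exists, not_and, not_not] at hess
    obtain ⟨y, hy, hyc⟩ := hess
    obtain ⟨r, hr, hr0⟩ := hI y hy
    rw [Submodule.eq_bot_iff]
    intro l hl
    refine (h l (r * y) fun s => ?_).resolve_right hr0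
    by_contra hls
    have hsplit (t : R) (ht : t * (c + s * (r * y)) = 0) :
        t * c = 0 ∧ t * (s * (r * y)) = 0 := by
      have h1 : t * s * r * y = 0 := hyc (t * s * r) (Ideal.mem_span_singleton'.2 ⟨-t, by
        rw [mul_add] at ht
        rw [smul_eq_mul, neg_mul, neg_eq_of_add_eq_zero_right ht]
        simp [mul_assoc]⟩)
      have h2 : t * (s * (r * y)) = 0 := by simpa [mul_assoc] using h1
      rw [mul_add, h2, add_zero] at ht
      exact ⟨ht, h2⟩
    refine hmax (ann (c + s * (r * y)))
      ⟨_, I.add_mem hcI (I.mul_mem_left s hr), rfl⟩ (lt_of_le_of_ne ?_ fun heq => hls ?_)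
    · intro x hx
      induction x using MulOpposite.rec' with | _ x
      rw [mem_ann] at hx ⊢
      exact fun t ht => hx t (hsplit t ht).1
    · have : MulOpposite.op (s * (r * y)) ∈ ann c := by
        rw [heq, mem_ann]
        exact fun t ht => (hsplit t ht).2
      rw [mem_ann] at this
      simpa [mul_assoc] using this l (by simpa using hl)
  have hc' (x : R) (hx : x * c = 0) : x = 0 := by
    have : x ∈ leftAnnihilator c := by simpa using hx
    rwa [hc, Submodule.mem_bot] at this
  refine ⟨c, hcI, mem_nonZeroDivisors_iff.2 ⟨fun x hx => ?_, hc'⟩⟩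
  refine h.eq_zero_of_isEssential_leftAnnihilator ((isEssential_span_singleton hc').mono ?_)
  rw [Ideal.span_le]
  simpa using hx

end Goldie

lemma LinearMap.exists_comp_eq_of_ker_le_ker {R M N P : Type*} [Ring R] [AddCommGroup M]
    [Module R M] [AddCommGroup N] [Module R N] [AddCommGroup P] [Module R P]
    {a : M →ₗ[R] N} (ha : Function.Surjective a) (b : M →ₗ[R] P)
    (h : LinearMap.ker a ≤ LinearMap.ker b) : ∃ c : N →ₗ[R] P, ∀ x, c (a x) = b x := by
  refine ⟨(LinearMap.ker a).liftQ b h ∘ₗ (a.quotKerEquivOfSurjective ha).symm, fun x => ?_⟩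
  have : (a.quotKerEquivOfSurjective ha).symm (a x) = (LinearMap.ker a).mkQ x := by
    rw [LinearEquiv.symm_apply_eq]
    rfl
  simp [this]

section Torsionless

/-- The elements which are carried into `H` by an essential left ideal. -/
def essentialClosure {R P : Type*} [Ring R] [AddCommGroup P] [Module R P] (H : Submodule R P) :
    Submodule R P where
  carrier := {p | IsEssentialSubmodule (H.comap (LinearMap.toSpanSingleton R P p))}
  add_mem' {p q} hp hq := (hp.inf hq).mono fun r hr => by
    simpa using H.add_mem hr.1 hr.2
  zero_mem' := IsEssentialSubmodule.top.mono fun r _ => by simp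
  smul_mem' a p hp := (hp.comap (LinearMap.toSpanSingleton R R a)).mono fun r hr => by
    simpa [mul_smul] using hr

variable {R N : Type} [Ring R] [IsNoetherianRing R] [IsNoetherianRing Rᵐᵒᵖ]
  [AddCommGroup N] [Module R N] [Module.Finite R N]

/-- A finitely generated torsionfree module over a prime noetherian ring is torsionless. -/
lemma IsPrimeRing.exists_linearMap_ne_zero (h : IsPrimeRing R)
    (hN : ∀ m : N, m ≠ 0 → ∀ c ∈ nonZeroDivisors R, c • m ≠ 0) {m : N} (hm : m ≠ 0) :
    ∃ f : N →ₗ[R] R, f m ≠ 0 := by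
  obtain ⟨x, hx0, hx⟩ : ∃ x : R, x ≠ 0 ∧ ∀ r : R, r • x • m = 0 → r * x = 0 := by
    by_contra! hcon
    obtain ⟨c, hc, hcreg⟩ := h.exists_mem_nonZeroDivisors_of_isEssential
      (I := LinearMap.ker (LinearMap.toSpanSingleton R N m)) fun x hx => by
        obtain ⟨r, hr, hr0⟩ := hcon x hx
        exact ⟨r, by simpa [mul_smul] using hr, hr0⟩
    exact hN m hm c hcreg (by simpa using hc)
  obtain ⟨V, hV, hess⟩ := exists_disjoint_sup_isEssential (Submodule.span R {x • m})
  let H : Submodule R (N × R) := Submodule.span R {(x • m, x)} ⊔ V.map (LinearMap.inl R N R)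
  have hess : IsEssentialSubmodule (H.map (LinearMap.fst R N R)) := hess.mono <| by
    rw [Submodule.map_sup, Submodule.map_span, ← Submodule.map_comp, LinearMap.fst_comp_inl,
      Submodule.map_id]
    simp
  have hH (y : R) (hy : (0, y) ∈ H) : y = 0 := by
    obtain ⟨p, hp, q, hq, hpq⟩ := Submodule.mem_sup.1 hy
    obtain ⟨s, rfl⟩ := Submodule.mem_span_singleton.1 hp
    obtain ⟨v, hv, rfl⟩ := hq
    simp only [Prod.smul_mk, LinearMap.inl_apply, Prod.mk_add_mk, Prod.mk.injEq, add_zero] at hpq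
    rw [← hpq.2]
    refine hx s (Submodule.disjoint_def.1 hV _ (Submodule.mem_span_singleton.2 ⟨s, rfl⟩) ?_)
    rw [eq_neg_of_add_eq_zero_left hpq.1]
    exact V.neg_mem hv
  let mulRight (d : R) : N × R →ₗ[R] N × R :=
    LinearMap.id.prodMap (LinearMap.toSpanSingleton R R d)
  have hden (S : Finset N) : ∃ D : Ideal Rᵐᵒᵖ, IsEssentialSubmodule D ∧ ∀ d : R, .op d ∈ D →
      ∀ n ∈ S, ∃ y : R, (n, y) ∈ essentialClosure (H.map (mulRight d)) := by
    classical
    induction S using Finset.induction_on with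
    | empty => exact ⟨⊤, .top, by simp⟩
    | insert n S _ ih =>
      obtain ⟨D, hD, hDS⟩ := ih
      obtain ⟨c, ⟨⟨_, b⟩, hb, rfl : _ = c • n⟩, hc⟩ :=
        h.exists_mem_nonZeroDivisors_of_isEssential
          (hess.comap (LinearMap.toSpanSingleton R N n))
      have hc := mem_nonZeroDivisors_iff.1 hc
      have hopc : IsEssentialSubmodule (Ideal.span {MulOpposite.op c}) :=
        isEssential_span_singleton fun x hx =>
          MulOpposite.unop_injective (hc.1 _ (congrArg MulOpposite.unop hx))
      refine ⟨D ⊓ Submodule.comap (LinearMap.toSpanSingleton Rᵐᵒᵖ Rᵐᵒᵖ (.op b))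
          (Ideal.span {MulOpposite.op c}),
        hD.inf (hopc.comap _), fun d hd k hk => ?_⟩
      obtain rfl | hk := Finset.mem_insert.1 hk
      · obtain ⟨y, hy⟩ := Ideal.mem_span_singleton'.1 hd.2
        have hy : c * y.unop = b * d := congrArg MulOpposite.unop hy
        refine ⟨y.unop, (isEssential_span_singleton hc.2).mono ?_⟩
        rw [Ideal.span_le, Set.singleton_subset_iff]
        exact ⟨_, hb, by simp [mulRight, hy]⟩
      · exact hDS d hd.1 k hk
  obtain ⟨S, hS⟩ := Module.Finite.fg_top (R := R) (M := N)
  obtain ⟨D, hD, hDS⟩ := hden S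
  obtain ⟨d, hd, hxd⟩ := h.op.exists_mul_ne_zero_of_isEssential hD
    (z := .op x) (by simpa using hx0)
  let G := essentialClosure (H.map (mulRight d.unop))
  have hsurj : Function.Surjective (LinearMap.fst R N R ∘ₗ G.subtype) := by
    rw [← LinearMap.range_eq_top, eq_top_iff, ← hS, Submodule.span_le]
    intro n hn
    obtain ⟨y, hy⟩ := hDS d.unop hd n hn
    exact ⟨⟨_, hy⟩, rfl⟩
  obtain ⟨f, hf⟩ := LinearMap.exists_comp_eq_of_ker_le_ker hsurj
    (LinearMap.snd R N R ∘ₗ G.subtype) (by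
      rintro ⟨⟨n, y⟩, hny⟩ (rfl : n = 0)
      refine h.eq_zero_of_isEssential_leftAnnihilator (IsEssentialSubmodule.mono hny ?_)
      rintro r ⟨⟨n, z⟩, hz, hnz⟩
      simp only [mulRight, LinearMap.prodMap_apply, LinearMap.toSpanSingleton_apply,
        Prod.smul_mk, smul_zero, LinearMap.id_apply, Prod.mk.injEq, smul_eq_mul] at hnz
      obtain ⟨rfl, hnz⟩ := hnz
      simpa [hH z hz] using hnz.symm)
  have hmem : (x • m, x * d.unop) ∈ G := by
    refine IsEssentialSubmodule.top.mono fun r _ =>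
      (H.map (mulRight d.unop)).smul_mem r ?_
    exact ⟨(x • m, x), Submodule.mem_sup_left (Submodule.mem_span_singleton_self _), rfl⟩
  have hfx : f (x • m) = x * d.unop := hf ⟨_, hmem⟩
  refine ⟨f, fun h0 => hxd (MulOpposite.unop_injective ?_)⟩
  rw [map_smul, h0, smul_zero] at hfx
  exact hfx.symm

/-- A finitely generated torsionfree module over a prime noetherian ring embeds in a finitely
generated free module. -/
theorem IsPrimeRing.exists_injective_of_torsionFree (h : IsPrimeRing R)
    (hN : ∀ m : N, m ≠ 0 → ∀ c ∈ nonZeroDivisors R, c • m ≠ 0) :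
    ∃ (n : ℕ) (f : N →ₗ[R] (Fin n → R)), Function.Injective f := by
  obtain ⟨k, s, hs⟩ := Module.Finite.exists_fin (R := R) (M := N)
  have : IsNoetherian Rᵐᵒᵖ R := isNoetherian_of_linearEquiv
    ({ (MulOpposite.opAddEquiv (α := R)).symm with map_smul' := fun _ _ => rfl } :
      Rᵐᵒᵖ ≃ₗ[Rᵐᵒᵖ] R)
  let ev : (N →ₗ[R] R) →ₗ[Rᵐᵒᵖ] (Fin k → R) :=
    { toFun := fun f i => f (s i)
      map_add' := fun _ _ => rfl
      map_smul' := fun _ _ => rfl }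
  have hev : Function.Injective ev := fun f g hfg =>
    LinearMap.ext_on_range hs (congrFun hfg)
  have : IsNoetherian Rᵐᵒᵖ (N →ₗ[R] R) := isNoetherian_of_injective ev hev
  obtain ⟨n, g, hg⟩ := Module.Finite.exists_fin (R := Rᵐᵒᵖ) (M := N →ₗ[R] R)
  refine ⟨n, LinearMap.pi g, (injective_iff_map_eq_zero _).2 fun m hm => ?_⟩
  by_contra hm0
  obtain ⟨f, hf⟩ := h.exists_linearMap_ne_zero hN hm0
  let K : Submodule Rᵐᵒᵖ (N →ₗ[R] R) :=
    { carrier := {f | f m = 0}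
      add_mem' := fun {a b} ha hb => by
        simp only [Set.mem_ofPred_eq] at ha hb ⊢
        simp [ha, hb]
      zero_mem' := rfl
      smul_mem' := fun c f hf => by
        simp only [Set.mem_ofPred_eq] at hf ⊢
        simp [hf] }
  have hK : K = ⊤ := by
    rw [eq_top_iff, ← hg, Submodule.span_le]
    rintro _ ⟨i, rfl⟩
    exact congrFun hm i
  exact hf (show f ∈ K by rw [hK]; trivial)

end Torsionless

section ExtensionProperty

variable {R : Type} [Ring R]

/-- Linear maps to `Y` extend along every embedding with cokernel `N`, that is,
`Ext¹(N, Y) = 0`. -/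
def ExtendsAlongKernels (R : Type) [Ring R] (N Y : Type) [AddCommGroup N] [Module R N]
    [AddCommGroup Y] [Module R Y] : Prop :=
  ∀ (E : Type) [AddCommGroup E] [Module R E] (g : E →ₗ[R] N), Function.Surjective g →
    ∀ φ : LinearMap.ker g →ₗ[R] Y, ∃ ψ : E →ₗ[R] Y, ∀ x : LinearMap.ker g, ψ x = φ x

variable {N Y G : Type} [AddCommGroup N] [Module R N] [AddCommGroup Y] [Module R Y]
  [AddCommGroup G] [Module R G]

/-- Dimension shifting: if `Ext²(G / N, Y) = 0` with `G` projective then `Ext¹(N, Y) = 0`. -/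
lemma ExtendsAlongKernels.of_injective [Module.Projective R G] (i : N →ₗ[R] G)
    (hi : Function.Injective i) {P₀ P₁ : Type} [AddCommGroup P₀] [Module R P₀] [AddCommGroup P₁]
    [Module R P₁] [Module.Projective R P₀] [Module.Projective R P₁]
    (d : P₁ →ₗ[R] P₀) (π : P₀ →ₗ[R] G ⧸ LinearMap.range i) (hπ : Function.Surjective π)
    (hd : LinearMap.range d = LinearMap.ker π)
    (hY : ∀ χ : LinearMap.ker d →ₗ[R] Y, ∃ θ : P₁ →ₗ[R] Y, ∀ x : LinearMap.ker d, θ x = χ x) :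
    ExtendsAlongKernels R N Y := by
  intro E _ _ e he φ
  obtain ⟨f₀, hf₀⟩ := Module.projective_lifting_property (LinearMap.range i).mkQ π
    (Submodule.mkQ_surjective _)
  obtain ⟨h₀, hh₀⟩ := Module.projective_lifting_property π (LinearMap.range i).mkQ hπ
  have lift {Q : Type} [AddCommGroup Q] [Module R Q] [Module.Projective R Q] (a : Q →ₗ[R] G)
      (ha : (LinearMap.range i).mkQ ∘ₗ a = 0) : ∃ b : Q →ₗ[R] E, ∀ q, i (e (b q)) = a q := by
    have ha' (q : Q) : a q ∈ LinearMap.range i := by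
      simpa using LinearMap.congr_fun ha q
    obtain ⟨b, hb⟩ := Module.projective_lifting_property
      (((LinearEquiv.ofInjective i hi : N →ₗ[R] LinearMap.range i)) ∘ₗ e)
      (a.codRestrict _ ha') ((LinearEquiv.ofInjective i hi).surjective.comp he)
    exact ⟨b, fun q => congrArg Subtype.val (LinearMap.congr_fun hb q)⟩
  obtain ⟨f₁, hf₁⟩ := lift (f₀ ∘ₗ d) (by
    rw [← LinearMap.comp_assoc, hf₀]
    exact LinearMap.range_le_ker_iff.1 hd.le)
  obtain ⟨s, hs⟩ := lift (f₀ ∘ₗ h₀ - LinearMap.id) (by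
    rw [LinearMap.comp_sub, ← LinearMap.comp_assoc, hf₀, hh₀]
    simp)
  have hker (p : LinearMap.ker d) : f₁ p ∈ LinearMap.ker e := by
    refine hi ?_
    simp [hf₁]
  obtain ⟨θ, hθ⟩ := hY (φ ∘ₗ (f₁ ∘ₗ (LinearMap.ker d).subtype).codRestrict _ hker)
  let W : Submodule R (E × P₁) := LinearMap.ker
    ((h₀ ∘ₗ i ∘ₗ e) ∘ₗ LinearMap.fst R E P₁ - d ∘ₗ LinearMap.snd R E P₁)
  have hW (w : W) : h₀ (i (e w.1.1)) = d w.1.2 := sub_eq_zero.1 w.2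
  let δ : E × P₁ →ₗ[R] E := (LinearMap.id + s ∘ₗ i ∘ₗ e).coprod (-f₁)
  have hδ (w : W) : δ w ∈ LinearMap.ker e := by
    refine hi ?_
    simp [δ, hs, hf₁, ← hW]
  have hsurj : Function.Surjective (LinearMap.fst R E P₁ ∘ₗ W.subtype) := by
    intro x
    have : h₀ (i (e x)) ∈ LinearMap.range d := by
      rw [hd, LinearMap.mem_ker, ← LinearMap.comp_apply, hh₀]
      simp
    obtain ⟨p, hp⟩ := this
    exact ⟨⟨(x, p), by simp [W, hp]⟩, rfl⟩
  obtain ⟨ψ, hψ⟩ := LinearMap.exists_comp_eq_of_ker_le_ker hsurj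
    (φ ∘ₗ (δ ∘ₗ W.subtype).codRestrict _ hδ + θ ∘ₗ LinearMap.snd R E P₁ ∘ₗ W.subtype) (by
      rintro ⟨⟨x, p⟩, hxp⟩ (rfl : x = 0)
      have hp : d p = 0 := by simpa using (hW ⟨_, hxp⟩).symm
      have h1 := hθ ⟨p, hp⟩
      simp only [LinearMap.mem_ker, LinearMap.add_apply, LinearMap.comp_apply,
        Submodule.subtype_apply, LinearMap.snd_apply] at h1 ⊢
      rw [h1, ← map_add]
      convert map_zero φ
      exact Subtype.ext (show δ (0, p) + f₁ p = 0 by simp [δ]))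
  refine ⟨ψ, fun x => ?_⟩
  have hx : e x = 0 := x.2
  refine (hψ ⟨(x, 0), by simp [W, hx]⟩).trans ?_
  simp only [LinearMap.add_apply, LinearMap.comp_apply, Submodule.subtype_apply,
    LinearMap.snd_apply, map_zero, add_zero]
  congr 1
  exact Subtype.ext (show δ (x, 0) = x by simp [δ, hx])

lemma ExtendsAlongKernels.of_projective {P : Type} [AddCommGroup P] [Module R P]
    [Module.Finite R P] [Module.Projective R P] (h : ExtendsAlongKernels R N R) :
    ExtendsAlongKernels R N P := by
  intro E _ _ g hg φ
  obtain ⟨n, p, q, -, -, hpq⟩ := Module.Finite.exists_comp_eq_id_of_projective R P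
  choose ψ hψ using fun i => h E g hg (LinearMap.proj i ∘ₗ q ∘ₗ φ)
  refine ⟨p ∘ₗ LinearMap.pi ψ, fun x => ?_⟩
  have : LinearMap.pi ψ (x : E) = q (φ x) := funext fun i => hψ i x
  rw [LinearMap.comp_apply, this, ← LinearMap.comp_apply, hpq, LinearMap.id_apply]

lemma ExtendsAlongKernels.projective (h : ∀ (Y : Type) [AddCommGroup Y] [Module R Y],
    ExtendsAlongKernels R N Y) : Module.Projective R N := by
  let g : (N →₀ R) →ₗ[R] N := Finsupp.linearCombination R id
  have hg : Function.Surjective g := Finsupp.linearCombination_id_surjective R N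
  obtain ⟨ψ, hψ⟩ := h (LinearMap.ker g) _ g hg LinearMap.id
  obtain ⟨s, hs⟩ := LinearMap.exists_comp_eq_of_ker_le_ker hg
    (LinearMap.id - (LinearMap.ker g).subtype ∘ₗ ψ) fun x hx => by
      simp [hψ ⟨x, hx⟩]
  refine Module.Projective.of_split s g (LinearMap.ext fun n => ?_)
  obtain ⟨x, rfl⟩ := hg n
  rw [LinearMap.comp_apply, hs]
  simp

end ExtensionProperty

section Ext

variable {R : Type} [Ring R]

lemma CategoryTheory.ProjectiveResolution.subsingleton_extGrp_succ_iff {X : ModuleCat.{0} R}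
    (P : ProjectiveResolution X) (Y : ModuleCat.{0} R) (n : ℕ) :
    Subsingleton (extGrp R (n + 1) X Y) ↔
      ∀ χ : P.complex.X (n + 1) ⟶ Y, P.complex.d (n + 2) (n + 1) ≫ χ = 0 →
        ∃ θ : P.complex.X n ⟶ Y, P.complex.d (n + 1) n ≫ θ = χ := by
  rw [(P.isoExt (R := ℤ) (n + 1) Y).toLinearEquiv.toEquiv.subsingleton_congr,
    ← ModuleCat.isZero_iff_subsingleton, ← HomologicalComplex.exactAt_iff_isZero_homology,
    HomologicalComplex.exactAt_iff' _ n (n + 1) (n + 2) (by simp) (by simp),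
    ShortComplex.moduleCat_exact_iff]
  rfl

lemma CategoryTheory.ProjectiveResolution.range_d_eq_ker_d {X : ModuleCat.{0} R}
    (P : ProjectiveResolution X) (n : ℕ) :
    LinearMap.range (P.complex.d (n + 2) (n + 1)).hom =
      LinearMap.ker (P.complex.d (n + 1) n).hom :=
  (ShortComplex.moduleCat_exact_iff_range_eq_ker _).1 (P.exact_succ n)

/-- The augmentation of a projective resolution, as a linear map. -/
noncomputable def CategoryTheory.ProjectiveResolution.augmentation {X : ModuleCat.{0} R}
    (P : ProjectiveResolution X) : P.complex.X 0 →ₗ[R] X :=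
  ModuleCat.Hom.hom (B := X) (P.π.f 0)

lemma CategoryTheory.ProjectiveResolution.range_d_eq_ker_augmentation {X : ModuleCat.{0} R}
    (P : ProjectiveResolution X) :
    LinearMap.range (P.complex.d 1 0).hom = LinearMap.ker P.augmentation :=
  (ShortComplex.moduleCat_exact_iff_range_eq_ker _).1 P.exact₀

lemma CategoryTheory.ProjectiveResolution.augmentation_surjective {X : ModuleCat.{0} R}
    (P : ProjectiveResolution X) : Function.Surjective P.augmentation :=
  (ModuleCat.epi_iff_surjective _).1 (inferInstanceAs (Epi (P.π.f 0)))

variable {N Y G : Type} [AddCommGroup N] [Module R N] [AddCommGroup Y] [Module R Y]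
  [AddCommGroup G] [Module R G]

lemma ExtendsAlongKernels.of_subsingleton_extGrp_two [Module.Projective R G] (i : N →ₗ[R] G)
    (hi : Function.Injective i)
    (h : Subsingleton (extGrp R 2 (.of R (G ⧸ LinearMap.range i)) (.of R Y))) :
    ExtendsAlongKernels R N Y := by
  let P := projectiveResolution (ModuleCat.of R (G ⧸ LinearMap.range i))
  have (n : ℕ) : Module.Projective R (P.complex.X n) :=
    (IsProjective.iff_projective _).2 (P.projective n)
  refine .of_injective i hi (P.complex.d 1 0).hom P.augmentation P.augmentation_surjective
    P.range_d_eq_ker_augmentation fun χ => ?_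
  have hd (x : P.complex.X 2) :
      (P.complex.d 2 1).hom x ∈ LinearMap.ker (P.complex.d 1 0).hom :=
    (P.range_d_eq_ker_d 0).le ⟨x, rfl⟩
  obtain ⟨θ, hθ⟩ := (P.subsingleton_extGrp_succ_iff _ 1).1 h
    (ModuleCat.ofHom (χ ∘ₗ (P.complex.d 2 1).hom.codRestrict _ hd)) (by
      ext x
      have hx : (P.complex.d 2 1).hom ((P.complex.d 3 2).hom x) = 0 :=
        (P.range_d_eq_ker_d 1).le ⟨x, rfl⟩
      refine (congrArg χ (Subtype.ext hx)).trans (map_zero χ))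
  refine ⟨θ.hom, fun x => ?_⟩
  obtain ⟨y, hy⟩ := (P.range_d_eq_ker_d 0).ge x.2
  have h1 : θ.hom ((P.complex.d 2 1).hom y) = χ ⟨(P.complex.d 2 1).hom y, hd y⟩ :=
    congrArg (fun f => f.hom y) hθ
  obtain rfl : ⟨_, hd y⟩ = x := Subtype.ext hy
  exact h1

lemma ExtendsAlongKernels.subsingleton_extGrp_one (h : ExtendsAlongKernels R N Y) :
    Subsingleton (extGrp R 1 (.of R N) (.of R Y)) := by
  let P := projectiveResolution (ModuleCat.of R N)
  rw [P.subsingleton_extGrp_succ_iff _ 0]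
  intro χ hχ
  have hd (x : P.complex.X 1) : (P.complex.d 1 0).hom x ∈ LinearMap.ker P.augmentation :=
    P.range_d_eq_ker_augmentation.le ⟨x, rfl⟩
  have hsurj : Function.Surjective ((P.complex.d 1 0).hom.codRestrict _ hd) := fun x => by
    obtain ⟨y, hy⟩ := P.range_d_eq_ker_augmentation.ge x.2
    exact ⟨y, Subtype.ext hy⟩
  obtain ⟨φ, hφ⟩ := LinearMap.exists_comp_eq_of_ker_le_ker hsurj χ.hom fun x hx => by
    obtain ⟨y, rfl⟩ := (P.range_d_eq_ker_d 0).ge (congrArg Subtype.val hx)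
    exact congrArg (fun f => f.hom y) hχ
  obtain ⟨ψ, hψ⟩ := h _ P.augmentation P.augmentation_surjective φ
  refine ⟨ModuleCat.ofHom ψ, ?_⟩
  ext x
  exact (hψ ⟨_, hd x⟩).trans (hφ x)

end Ext

section SelfExtension

variable {R : Type} [Ring R]

lemma Module.Projective.ker_of_comp_eq_id {F P : Type*} [AddCommGroup F] [Module R F]
    [AddCommGroup P] [Module R P] [Module.Projective R F] (p : F →ₗ[R] P) (i : P →ₗ[R] F)
    (h : p ∘ₗ i = LinearMap.id) : Module.Projective R (LinearMap.ker p) := by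
  have hmem (x : F) : ((LinearMap.id : F →ₗ[R] F) - i ∘ₗ p) x ∈ LinearMap.ker p := by
    have := LinearMap.congr_fun h (p x)
    simp only [LinearMap.comp_apply, LinearMap.id_apply] at this
    simp [this]
  refine .of_split (LinearMap.ker p).subtype (LinearMap.codRestrict _ _ hmem)
    (LinearMap.ext fun x => Subtype.ext ?_)
  simp

/-- If `0 → N ⊕ Q → F → N ⊕ P → 0` is exact with `F`, `P`, `Q` finitely generated projective and
`Ext¹(N, R) = 0`, then `N` is an extension of itself with projective middle term. -/
lemma ExtendsAlongKernels.exists_self_extension [IsNoetherianRing R] {N P Q F : Type}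
    [AddCommGroup N] [Module R N] [AddCommGroup P] [Module R P] [AddCommGroup Q] [Module R Q]
    [AddCommGroup F] [Module R F] [Module.Projective R P] [Module.Projective R Q]
    [Module.Finite R Q] [Module.Projective R F] [Module.Finite R F]
    (hN : ExtendsAlongKernels R N R) (g : F →ₗ[R] N × P) (hg : Function.Surjective g)
    (e : LinearMap.ker g ≃ₗ[R] N × Q) :
    ∃ L : ModuleCat.{0} R, Module.Projective R L ∧ Module.Finite R L ∧
      ∃ (f : N →ₗ[R] L) (g : L →ₗ[R] N),
        Function.Injective f ∧ Function.Surjective g ∧ Function.Exact f g := by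
  let p : F →ₗ[R] P := LinearMap.snd R N P ∘ₗ g
  obtain ⟨i, hi⟩ := Module.projective_lifting_property p LinearMap.id
    (Prod.snd_surjective.comp hg)
  have := Module.Projective.ker_of_comp_eq_id p i hi
  let a : LinearMap.ker p →ₗ[R] N := LinearMap.fst R N P ∘ₗ g ∘ₗ (LinearMap.ker p).subtype
  have ha : Function.Surjective a := fun n => by
    obtain ⟨x, hx⟩ := hg (n, 0)
    exact ⟨⟨x, by simp [p, hx]⟩, by simp [a, hx]⟩
  have hag (x : LinearMap.ker a) : ((x : LinearMap.ker p) : F) ∈ LinearMap.ker g :=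
    Prod.ext x.2 x.1.2
  let c : LinearMap.ker a →ₗ[R] LinearMap.ker g :=
    ((LinearMap.ker p).subtype ∘ₗ (LinearMap.ker a).subtype).codRestrict _ hag
  have hgp (y : LinearMap.ker g) : (y : F) ∈ LinearMap.ker p := by
    simp [p]
  let j : N × Q →ₗ[R] LinearMap.ker p :=
    ((LinearMap.ker g).subtype.codRestrict _ hgp) ∘ₗ e.symm.toLinearMap
  have hj (z : N × Q) : j z ∈ LinearMap.ker a :=
    congrArg Prod.fst (e.symm z).2
  have hcj (z : N × Q) : c ⟨j z, hj z⟩ = e.symm z := rfl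
  obtain ⟨ρ, hρ⟩ := hN.of_projective (P := Q) _ a ha (LinearMap.snd R N Q ∘ₗ e.toLinearMap ∘ₗ c)
  have hρj (z : N × Q) : ρ (j z) = z.2 :=
    (hρ ⟨j z, hj z⟩).trans (by simp [hcj])
  have := Module.Projective.ker_of_comp_eq_id ρ (j ∘ₗ LinearMap.inr R N Q)
    (LinearMap.ext fun r => hρj _)
  refine ⟨.of R (LinearMap.ker ρ), inferInstanceAs (Module.Projective R (LinearMap.ker ρ)),
    inferInstanceAs (Module.Finite R (LinearMap.ker ρ)),
    (j ∘ₗ LinearMap.inl R N Q).codRestrict (LinearMap.ker ρ) fun n => hρj _,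
    a ∘ₗ (LinearMap.ker ρ).subtype, fun m n hmn => ?_, fun n => ?_, fun x => ⟨fun hx => ?_, ?_⟩⟩
  · have h1 : e.symm (m, 0) = e.symm (n, 0) :=
      Subtype.ext (congrArg (fun x : LinearMap.ker ρ => (x.1 : F)) hmn)
    exact congrArg Prod.fst (e.symm.injective h1)
  · obtain ⟨x, rfl⟩ := ha n
    refine ⟨⟨x - j (0, ρ x), by simp [hρj]⟩, ?_⟩
    have : a (j (0, ρ x)) = 0 := hj _
    simp [this]
  · have h1 := hρ ⟨x.1, hx⟩
    have hx0 : (e (c ⟨x.1, hx⟩)).2 = 0 := h1.symm.trans x.2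
    have h2 : e.symm ((e (c ⟨x.1, hx⟩)).1, 0) = c ⟨x.1, hx⟩ := by
      rw [LinearEquiv.symm_apply_eq]
      exact Prod.ext rfl hx0.symm
    have h3 := congrArg Subtype.val h2
    exact ⟨(e (c ⟨x.1, hx⟩)).1, Subtype.ext (Subtype.ext h3)⟩
  · rintro ⟨n, rfl⟩
    exact hj _

/-- The same conclusion when `N` is stably a power of a module `M` which is stably isomorphic to
its first syzygy. -/
lemma ExtendsAlongKernels.exists_self_extension_of_syzygy [IsNoetherianRing R]
    {N M P Q P₀ P₁ Q₁ : Type} {s : ℕ}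
    [AddCommGroup N] [Module R N] [AddCommGroup M] [Module R M]
    [AddCommGroup P] [Module R P] [AddCommGroup Q] [Module R Q]
    [AddCommGroup P₀] [Module R P₀] [AddCommGroup P₁] [Module R P₁] [AddCommGroup Q₁] [Module R Q₁]
    [Module.Projective R P] [Module.Finite R P] [Module.Projective R Q] [Module.Finite R Q]
    [Module.Projective R P₀] [Module.Finite R P₀] [Module.Projective R P₁] [Module.Finite R P₁]
    [Module.Projective R Q₁] [Module.Finite R Q₁]
    (hN : ExtendsAlongKernels R N R) (e : (N × P) ≃ₗ[R] (Fin s → M) × Q)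
    (p : P₀ →ₗ[R] M) (hp : Function.Surjective p)
    (e₁ : (LinearMap.ker p × P₁) ≃ₗ[R] M × Q₁) :
    ∃ L : ModuleCat.{0} R, Module.Projective R L ∧ Module.Finite R L ∧
      ∃ (f : N →ₗ[R] L) (g : L →ₗ[R] N),
        Function.Injective f ∧ Function.Surjective g ∧ Function.Exact f g := by
  let q : (Fin s → P₀ × P₁) × (Q × Q) →ₗ[R] (Fin s → M) × Q :=
    (LinearMap.pi fun j => p ∘ₗ LinearMap.fst R P₀ P₁ ∘ₗ LinearMap.proj j).prodMap
      (LinearMap.snd R Q Q)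
  have hq : Function.Surjective q := fun ⟨m, y⟩ => by
    choose x hx using fun j => hp (m j)
    exact ⟨(fun j => (x j, 0), (0, y)), Prod.ext (funext hx) rfl⟩
  let ι : (Fin s → LinearMap.ker p × P₁) × Q →ₗ[R] (Fin s → P₀ × P₁) × (Q × Q) :=
    (LinearMap.pi fun j => ((LinearMap.ker p).subtype.prodMap LinearMap.id) ∘ₗ
      LinearMap.proj j).prodMap (LinearMap.inl R Q Q)
  have hι : Function.Injective ι := by
    rintro ⟨x, y⟩ ⟨x', y'⟩ h
    simp only [ι, LinearMap.prodMap_apply, Prod.mk.injEq, LinearMap.inl_apply, and_true] at h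
    refine Prod.ext (funext fun j => ?_) h.2
    have := congrFun h.1 j
    simp only [LinearMap.pi_apply, LinearMap.comp_apply, LinearMap.proj_apply,
      LinearMap.prodMap_apply, Submodule.subtype_apply, LinearMap.id_apply, Prod.mk.injEq] at this
    exact Prod.ext (Subtype.ext this.1) this.2
  let g : (Fin s → P₀ × P₁) × (Q × Q) →ₗ[R] N × P := e.symm.toLinearMap ∘ₗ q
  have hrange : LinearMap.range ι = LinearMap.ker g := by
    rw [LinearEquiv.ker_comp]
    refine le_antisymm ?_ fun x hx => ?_
    · rintro _ ⟨x, rfl⟩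
      exact Prod.ext (funext fun j => (x.1 j).1.2) rfl
    · have hx1 (j : Fin s) : p (x.1 j).1 = 0 := congrFun (congrArg Prod.fst hx) j
      have hx2 : x.2.2 = 0 := congrArg Prod.snd hx
      exact ⟨(fun j => (⟨(x.1 j).1, hx1 j⟩, (x.1 j).2), x.2.1),
        Prod.ext rfl (Prod.ext rfl hx2.symm)⟩
  let e₂ : (Fin s → M × Q₁) ≃ₗ[R] (Fin s → M) × (Fin s → Q₁) :=
    { toFun := fun f => (fun j => (f j).1, fun j => (f j).2)
      invFun := fun f j => (f.1 j, f.2 j)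
      map_add' := fun _ _ => rfl
      map_smul' := fun _ _ => rfl
      left_inv := fun _ => rfl
      right_inv := fun _ => rfl }
  let e₃ : LinearMap.ker g ≃ₗ[R] N × (P × (Fin s → Q₁)) :=
    (LinearEquiv.ofEq _ _ hrange).symm ≪≫ₗ (LinearEquiv.ofInjective ι hι).symm ≪≫ₗ
    ((LinearEquiv.piCongrRight fun _ => e₁) ≪≫ₗ e₂).prodCongr (LinearEquiv.refl R Q) ≪≫ₗ
    LinearEquiv.prodAssoc R _ _ _ ≪≫ₗ
    (LinearEquiv.refl R _).prodCongr (LinearEquiv.prodComm R _ _) ≪≫ₗ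
    (LinearEquiv.prodAssoc R _ _ _).symm ≪≫ₗ
    e.symm.prodCongr (LinearEquiv.refl R _) ≪≫ₗ
    LinearEquiv.prodAssoc R _ _ _
  have hpi {K : Type} [AddCommGroup K] [Module R K] [Module.Projective R K] :
      Module.Projective R (Fin s → K) :=
    .of_equiv' (DFinsupp.linearEquivFunOnFintype (R := R) (M := fun _ : Fin s => K))
  have := hpi (K := P₀ × P₁)
  have := hpi (K := Q₁)
  exact hN.exists_self_extension g (e.symm.surjective.comp hq) e₃

lemma exists_self_extension_ulift.{u} {N : Type} [AddCommGroup N] [Module R N]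
    (h : ∃ L : ModuleCat.{0} R, Module.Projective R L ∧ Module.Finite R L ∧
      ∃ (f : N →ₗ[R] L) (g : L →ₗ[R] N),
        Function.Injective f ∧ Function.Surjective g ∧ Function.Exact f g) :
    ∃ L : ModuleCat.{u} R, Module.Projective R L ∧ Module.Finite R L ∧
      ∃ (f : N →ₗ[R] L) (g : L →ₗ[R] N),
        Function.Injective f ∧ Function.Surjective g ∧ Function.Exact f g := by
  obtain ⟨L, _, _, f, g, hf, hg, hfg⟩ := h
  let d : ULift.{u} L ≃ₗ[R] L := ULift.moduleEquiv
  refine ⟨.of R (ULift.{u} L), inferInstanceAs (Module.Projective R (ULift L)),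
    inferInstanceAs (Module.Finite R (ULift L)), d.symm.toLinearMap ∘ₗ f, g ∘ₗ d.toLinearMap,
    d.symm.injective.comp hf, hg.comp d.surjective, fun x => (hfg (d x)).trans ?_⟩
  exact exists_congr fun n => ⟨fun h => (LinearEquiv.symm_apply_eq d).2 h,
    fun h => (LinearEquiv.symm_apply_eq d).1 h⟩

end SelfExtension

theorem stmt_3 (k A : Type) [Field k] [Ring A] [Algebra k A]
    (hprime : IsPrimeRing A)
    (hnoethR : IsNoetherianRing Aᵐᵒᵖ) (hnoethL : IsNoetherianRing A)
    (hinjR : RightSelfInjDimLE A 1) (hinjL : LeftSelfInjDimLE A 1)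
    (hinjR' : ¬ RightSelfInjDimLE A 0)
    (hA : IsHereditaryRing A ∨ HasA1Singularity k A)
    (N : Type) [AddCommGroup N] [Module Aᵐᵒᵖ N] [Module.Finite Aᵐᵒᵖ N]
    (hN0 : Nontrivial N) (hNtf : RightTorsionFree A N) :
    ∃ (L : ModuleCat Aᵐᵒᵖ), Module.Projective Aᵐᵒᵖ L ∧ Module.Finite Aᵐᵒᵖ L ∧
      ∃ (f : N →ₗ[Aᵐᵒᵖ] L) (g : L →ₗ[Aᵐᵒᵖ] N),
        Function.Injective f ∧ Function.Surjective g ∧ Function.Exact f g := by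
  apply exists_self_extension_ulift
  have := isNoetherianRing_of_ringEquiv A (RingEquiv.opOp A)
  obtain ⟨n, i, hi⟩ := (IsPrimeRing.op hprime).exists_injective_of_torsionFree
    (N := N) fun m hm c hc => hNtf m hm c.unop <| by
      obtain ⟨h1, h2⟩ := mem_nonZeroDivisors_iff.1 hc
      exact mem_nonZeroDivisors_iff.2
        ⟨fun x hx => MulOpposite.op_injective (h2 (.op x) (MulOpposite.unop_injective hx)),
          fun x hx => MulOpposite.op_injective (h1 (.op x) (MulOpposite.unop_injective hx))⟩
  rcases hA with hA | ⟨M, -, -, -, hM, -, -, P₀, p, _, _, hp, P₁, Q₁, _, _, _, _, ⟨e₁⟩⟩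
  · have : Module.Projective Aᵐᵒᵖ N := ExtendsAlongKernels.projective fun Y _ _ =>
      .of_subsingleton_extGrp_two i hi (hA _ _ 2 one_lt_two)
    exact ⟨.of Aᵐᵒᵖ (N × N), inferInstanceAs (Module.Projective Aᵐᵒᵖ (N × N)),
      inferInstanceAs (Module.Finite Aᵐᵒᵖ (N × N)), .inl _ _ _, .snd _ _ _,
      LinearMap.inl_injective, Prod.snd_surjective, Function.Exact.inl_snd⟩
  · have hN : ExtendsAlongKernels Aᵐᵒᵖ N Aᵐᵒᵖ :=
      .of_subsingleton_extGrp_two i hi (hinjR _ 2 one_lt_two)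
    obtain ⟨s, P, Q, _, _, _, _, ⟨e⟩⟩ := hM (.of Aᵐᵒᵖ N) ‹_› fun n hn => by
      obtain rfl | hn := (Nat.succ_le_of_lt hn).eq_or_lt
      · exact hN.subsingleton_extGrp_one
      · exact hinjR _ n hn
    exact hN.exists_self_extension_of_syzygy e p hp e₁
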